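/- Explicit TRO implementing transitivity: Let H, K, L be complex Hilbert spaces, let A ⊆ B(H), B ⊆ B(K), C ⊆ B(L) be norm-closed subalgebras, and suppose there are TROs M ⊆ B(H,K) and N ⊆ B(K,L) such that A = [M*BM], B = [MAM*], B = [N*CN], and C = [NBN*]. Let D ⊆ B(K) be the smallest norm-closed *-subalgebra containing {m₁ m₂* : m₁, m₂ ∈ M} and {n₁* n₂ : n₁, n₂ ∈ N}, and set T = [{n d m : n ∈ N, d ∈ D, m ∈ M}] ⊆ B(H,L). Then T T* T ⊆ T (so T is a TRO), C = [TAT*], and A = [T*CT]. -/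

import Mathlib

noncomputable section

open ContinuousLinearMap

/-- The norm-closed linear span of a set of operators. -/
def clspan {V : Type*} [NormedAddCommGroup V] [NormedSpace ℂ V] (S : Set V) : Set V :=
  closure (Submodule.span ℂ S : Set V)

/-- A set is a norm-closed linear subspace. -/
def IsClosedSubspace {V : Type*} [NormedAddCommGroup V] [NormedSpace ℂ V] (S : Set V) : Prop :=
  IsClosed S ∧ ∃ p : Submodule ℂ V, (p : Set V) = S

variable {H K L R : Type*}
  [NormedAddCommGroup H] [InnerProductSpace ℂ H] [CompleteSpace H]
  [NormedAddCommGroup K] [InnerProductSpace ℂ K] [CompleteSpace K]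
  [NormedAddCommGroup L] [InnerProductSpace ℂ L] [CompleteSpace L]
  [NormedAddCommGroup R] [InnerProductSpace ℂ R] [CompleteSpace R]

/-- A ternary ring of operators: a norm-closed subspace `M ⊆ B(H,K)` with `M M* M ⊆ M`. -/
def IsTRO (M : Set (H →L[ℂ] K)) : Prop :=
  IsClosedSubspace M ∧
    ∀ m₁ ∈ M, ∀ m₂ ∈ M, ∀ m₃ ∈ M, m₁ ∘L ((adjoint m₂) ∘L m₃) ∈ M

/-- A norm-closed subalgebra of `B(H)`. -/
def IsClosedSubalgebra (A : Set (H →L[ℂ] H)) : Prop :=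
  IsClosedSubspace A ∧ ∀ a ∈ A, ∀ b ∈ A, a * b ∈ A

/-- `[M* B M]`, the norm-closed linear span of `{m₁* b m₂ : m₁, m₂ ∈ M, b ∈ B}`. -/
def conjTRO (M : Set (H →L[ℂ] K)) (B : Set (K →L[ℂ] K)) : Set (H →L[ℂ] H) :=
  clspan {x | ∃ m₁ ∈ M, ∃ m₂ ∈ M, ∃ b ∈ B, x = (adjoint m₁) ∘L (b ∘L m₂)}

/-- `[M A M*]`, the norm-closed linear span of `{m₁ a m₂* : m₁, m₂ ∈ M, a ∈ A}`. -/
def conjTRO' (M : Set (H →L[ℂ] K)) (A : Set (H →L[ℂ] H)) : Set (K →L[ℂ] K) :=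
  clspan {x | ∃ m₁ ∈ M, ∃ m₂ ∈ M, ∃ a ∈ A, x = m₁ ∘L (a ∘L (adjoint m₂))}

/-- An algebra `A ⊆ B(H)` acts nondegenerately: the span of `A(H)` is dense in `H`. -/
def Nondegenerate (A : Set (H →L[ℂ] H)) : Prop :=
  Dense (Submodule.span ℂ {v : H | ∃ a ∈ A, ∃ h : H, v = a h} : Set H)

/-- A contractive approximate identity for `A`: a net `(e t)` in the unit ball of `A`
with `‖e t * a - a‖ → 0` and `‖a * e t - a‖ → 0` for every `a ∈ A`. -/
def HasCai (A : Set (H →L[ℂ] H)) : Prop :=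
  ∃ (ι : Type) (_ : Preorder ι) (_ : IsDirected ι (· ≤ ·)) (_ : Nonempty ι)
    (e : ι → (H →L[ℂ] H)),
    (∀ t, e t ∈ A) ∧ (∀ t, ‖e t‖ ≤ 1) ∧
    ∀ a ∈ A, Filter.Tendsto (fun t => ‖e t * a - a‖) Filter.atTop (nhds 0) ∧
      Filter.Tendsto (fun t => ‖a * e t - a‖) Filter.atTop (nhds 0)

/-- A countable approximate identity for `A`: a sequence `(e n)` in `A` with
`‖e n * a - a‖ → 0` and `‖a * e n - a‖ → 0` for every `a ∈ A`. -/
def HasCountableAI (A : Set (H →L[ℂ] H)) : Prop :=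
  ∃ e : ℕ → (H →L[ℂ] H), (∀ n, e n ∈ A) ∧
    ∀ a ∈ A, Filter.Tendsto (fun n => ‖e n * a - a‖) Filter.atTop (nhds 0) ∧
      Filter.Tendsto (fun n => ‖a * e n - a‖) Filter.atTop (nhds 0)

/-- The operator on the ℓ²-direct sum `R^n` associated to an `n × n` matrix of operators. -/
def matrixOp {n : ℕ} (x : Fin n → Fin n → (R →L[ℂ] R)) :
    (PiLp 2 fun _ : Fin n => R) →L[ℂ] (PiLp 2 fun _ : Fin n => R) :=
  ((PiLp.continuousLinearEquiv 2 ℂ (fun _ : Fin n => R)).symm.toContinuousLinearMap.comp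
      (ContinuousLinearMap.pi fun i =>
        ∑ j, (x i j).comp (ContinuousLinearMap.proj j))).comp
    (PiLp.continuousLinearEquiv 2 ℂ (fun _ : Fin n => R)).toContinuousLinearMap

/-- `φ` is completely isometric on a subspace `A ⊆ B(R)`: every matrix amplification of `φ`
preserves the operator matrix norms. -/
def CompletelyIsometricOn (A : Set (R →L[ℂ] R)) (φ : (R →L[ℂ] R) → (H →L[ℂ] H)) : Prop :=
  ∀ (n : ℕ) (x : Fin n → Fin n → (R →L[ℂ] R)), (∀ i j, x i j ∈ A) →
    ‖matrixOp (fun i j => φ (x i j))‖ = ‖matrixOp x‖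

/-- `α` is a completely isometric nondegenerate representation of the operator algebra
`A ⊆ B(R)` on the Hilbert space `H`: it is linear and multiplicative on `A`,
completely isometric on `A`, and the span of `α(A)H` is dense in `H`. -/
def IsCIRepOn (A : Set (R →L[ℂ] R)) (α : (R →L[ℂ] R) → (H →L[ℂ] H)) : Prop :=
  (∀ a ∈ A, ∀ b ∈ A, α (a + b) = α a + α b) ∧
  (∀ (c : ℂ), ∀ a ∈ A, α (c • a) = c • α a) ∧
  (∀ a ∈ A, ∀ b ∈ A, α (a * b) = α a * α b) ∧
  CompletelyIsometricOn A α ∧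
  Dense (Submodule.span ℂ {v : H | ∃ a ∈ A, ∃ h : H, v = α a h} : Set H)

/-- Two concretely represented operator algebras are strongly TRO equivalent. -/
def StronglyTROEquivalent (X : Set (H →L[ℂ] H)) (Y : Set (K →L[ℂ] K)) : Prop :=
  ∃ M : Set (H →L[ℂ] K), IsTRO M ∧ X = conjTRO M Y ∧ Y = conjTRO' M X

/-- Two operator algebras are strongly Δ-equivalent: they admit completely isometric
nondegenerate representations with strongly TRO equivalent ranges. -/
def StronglyDeltaEquivalent (A : Set (H →L[ℂ] H)) (B : Set (K →L[ℂ] K)) : Prop :=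
  ∃ (H' K' : Type) (_ : NormedAddCommGroup H') (_ : InnerProductSpace ℂ H')
    (_ : CompleteSpace H') (_ : NormedAddCommGroup K') (_ : InnerProductSpace ℂ K')
    (_ : CompleteSpace K')
    (α : (H →L[ℂ] H) → (H' →L[ℂ] H')) (β : (K →L[ℂ] K) → (K' →L[ℂ] K')),
    IsCIRepOn A α ∧ IsCIRepOn B β ∧ StronglyTROEquivalent (α '' A) (β '' B)

/-- The Hilbert space `ℓ²(H)` of square-summable sequences in `H`. -/
abbrev l2 (H : Type*) [NormedAddCommGroup H] [InnerProductSpace ℂ H] : Type _ :=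
  lp (fun _ : ℕ => H) 2

/-- The isometric embedding `S_i` of `H` onto the `i`-th coordinate of `ℓ²(H)`. -/
def lpSingle (i : ℕ) : H →L[ℂ] l2 H :=
  LinearMap.mkContinuous
    { toFun := fun a => lp.single 2 i a
      map_add' := fun a b => by
        apply lp.ext
        funext j
        by_cases h : j = i
        · subst h; simp [lp.single_apply_self]
        · simp [lp.single_apply_ne _ _ _ h, lp.coeFn_add]
      map_smul' := fun c a => by simp }
    1 (fun a => by
      simpa using (lp.norm_single (p := 2) (by norm_num) (fun _ : ℕ => a) i).le)

/-- The stabilization `K_∞(A) = [{S_i a S_j* : a ∈ A, i, j ∈ ℕ}] ⊆ B(ℓ²(H))`. -/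
def Kinf (A : Set (H →L[ℂ] H)) : Set (l2 H →L[ℂ] l2 H) :=
  clspan {x | ∃ a ∈ A, ∃ i j : ℕ, x = (lpSingle i) ∘L (a ∘L (adjoint (lpSingle j)))}



theorem clspan_sub {V : Type*} [NormedAddCommGroup V] [NormedSpace ℂ V] (S : Set V) :
    IsClosedSubspace (clspan S) :=
  ⟨isClosed_closure, (Submodule.span ℂ S).topologicalClosure, rfl⟩

theorem mem_clspan {V : Type*} [NormedAddCommGroup V] [NormedSpace ℂ V] {S : Set V} {x : V}
    (h : x ∈ S) : x ∈ clspan S := subset_closure (Submodule.subset_span h)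

theorem clspan_map {V W : Type*} [NormedAddCommGroup V] [NormedSpace ℂ V]
    [NormedAddCommGroup W] [NormedSpace ℂ W] {S : Set V} {P : Set W} (hP : IsClosedSubspace P)
    (f : V → W) (hc : Continuous f) (ha : ∀ x y, f (x + y) = f x + f y)
    (hs : ∀ (c : ℂ) x, ∃ c' : ℂ, f (c • x) = c' • f x)
    (h : ∀ x ∈ S, f x ∈ P) : ∀ x ∈ clspan S, f x ∈ P := by
  obtain ⟨hcl, p, rfl⟩ := hP
  have h0 : f 0 = 0 := by simpa using ha 0 0
  have h1 : (Submodule.span ℂ S : Set V) ⊆ f ⁻¹' p := by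
    intro x hx
    refine Submodule.span_induction (p := fun x _ => f x ∈ p) h ?_ ?_ ?_ hx
    · rw [h0]; exact p.zero_mem
    · intro x y _ _ hx hy
      rw [ha]; exact p.add_mem hx hy
    · intro c x _ hx
      obtain ⟨c', e⟩ := hs c x
      rw [e]; exact p.smul_mem _ hx
  exact fun x hx => closure_minimal h1 (hcl.preimage hc) hx

section
variable {E F G X : Type*}
  [NormedAddCommGroup E] [InnerProductSpace ℂ E] [CompleteSpace E]
  [NormedAddCommGroup F] [InnerProductSpace ℂ F] [CompleteSpace F]
  [NormedAddCommGroup G] [InnerProductSpace ℂ G] [CompleteSpace G]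
  [NormedAddCommGroup X] [InnerProductSpace ℂ X] [CompleteSpace X]

theorem clspan_sandwich {S : Set (F →L[ℂ] G)} {P : Set (E →L[ℂ] X)} (hP : IsClosedSubspace P)
    (p : G →L[ℂ] X) (q : E →L[ℂ] F)
    (h : ∀ x ∈ S, p ∘L (x ∘L q) ∈ P) : ∀ x ∈ clspan S, p ∘L (x ∘L q) ∈ P := by
  refine clspan_map hP (fun x => p ∘L (x ∘L q)) (by fun_prop) ?_ ?_ h
  · intro x y; simp
  · intro c x; exact ⟨c, by simp⟩

theorem clspan_sandwich_adj {S : Set (G →L[ℂ] F)} {P : Set (E →L[ℂ] X)} (hP : IsClosedSubspace P)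
    (p : G →L[ℂ] X) (q : E →L[ℂ] F)
    (h : ∀ x ∈ S, p ∘L (adjoint x ∘L q) ∈ P) :
    ∀ x ∈ clspan S, p ∘L (adjoint x ∘L q) ∈ P := by
  refine clspan_map hP (fun x => p ∘L (adjoint x ∘L q)) ?_ ?_ ?_ h
  · have : Continuous (fun x : G →L[ℂ] F => adjoint x) := adjoint.continuous
    fun_prop
  · intro x y; simp
  · intro c x; exact ⟨starRingEnd ℂ c, by simp only [map_smulₛₗ, smul_comp, comp_smul]⟩

theorem clspan_left {S : Set (F →L[ℂ] G)} {P : Set (F →L[ℂ] X)} (hP : IsClosedSubspace P)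
    (p : G →L[ℂ] X) 
    (h : ∀ x ∈ S, p ∘L x ∈ P) : ∀ x ∈ clspan S, p ∘L x ∈ P :=
  clspan_sandwich hP p (.id ℂ F) h

theorem clspan_right {S : Set (F →L[ℂ] G)} {P : Set (E →L[ℂ] G)} (hP : IsClosedSubspace P)
    (q : E →L[ℂ] F) 
    (h : ∀ x ∈ S, x ∘L q ∈ P) : ∀ x ∈ clspan S, x ∘L q ∈ P :=
  clspan_sandwich hP (.id ℂ G) q h

theorem clspan_id {S : Set (F →L[ℂ] G)} {P : Set (F →L[ℂ] G)} (hP : IsClosedSubspace P)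
    (h : ∀ x ∈ S, x ∈ P) : ∀ x ∈ clspan S, x ∈ P :=
  clspan_left hP (.id ℂ G) h

theorem clspan_adj {S : Set (F →L[ℂ] G)} {P : Set (F →L[ℂ] X)} (hP : IsClosedSubspace P)
    (q : F →L[ℂ] G) (p : F →L[ℂ] X)
    (h : ∀ x ∈ S, p ∘L (adjoint x ∘L q) ∈ P) :
    ∀ x ∈ clspan S, p ∘L (adjoint x ∘L q) ∈ P :=
  clspan_sandwich_adj hP p q h
end

/-- The explicit TRO `T = [N D M]` implements the transitivity of strong
TRO equivalence, where `D` is the smallest norm-closed `*`-subalgebra of `B(K)` containing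
`{m₁ m₂*}` and `{n₁* n₂}`. -/
theorem explicit_TRO_transitivity
    (A : Set (H →L[ℂ] H)) (B : Set (K →L[ℂ] K)) (C : Set (L →L[ℂ] L))
    (hA : IsClosedSubalgebra A) (hB : IsClosedSubalgebra B) (hC : IsClosedSubalgebra C)
    (M : Set (H →L[ℂ] K)) (N : Set (K →L[ℂ] L)) (hM : IsTRO M) (hN : IsTRO N)
    (hAB : A = conjTRO M B) (hBA : B = conjTRO' M A)
    (hBC : B = conjTRO N C) (hCB : C = conjTRO' N B)
    (D : Set (K →L[ℂ] K))
    (hD : D = closure (NonUnitalStarAlgebra.adjoin ℂ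
      ({x | ∃ m₁ ∈ M, ∃ m₂ ∈ M, x = m₁ ∘L (adjoint m₂)} ∪
        {x | ∃ n₁ ∈ N, ∃ n₂ ∈ N, x = (adjoint n₁) ∘L n₂}) : Set (K →L[ℂ] K)))
    (T : Set (H →L[ℂ] L))
    (hT : T = clspan {x | ∃ n ∈ N, ∃ d ∈ D, ∃ m ∈ M, x = n ∘L (d ∘L m)}) :
    (∀ t₁ ∈ T, ∀ t₂ ∈ T, ∀ t₃ ∈ T, t₁ ∘L ((adjoint t₂) ∘L t₃) ∈ T) ∧
      C = conjTRO' T A ∧ A = conjTRO T C := by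
  have sA : IsClosedSubspace A := hA.1
  have sB : IsClosedSubspace B := hB.1
  have sC : IsClosedSubspace C := hC.1
  have sT : IsClosedSubspace T := hT ▸ clspan_sub _
  -- basic memberships
  have MAM : ∀ m₁ ∈ M, ∀ m₂ ∈ M, ∀ a ∈ A, m₁ ∘L (a ∘L adjoint m₂) ∈ B := by
    intro m₁ h₁ m₂ h₂ a ha
    rw [hBA]; exact mem_clspan ⟨m₁, h₁, m₂, h₂, a, ha, rfl⟩
  have MBM : ∀ m₁ ∈ M, ∀ m₂ ∈ M, ∀ b ∈ B, adjoint m₁ ∘L (b ∘L m₂) ∈ A := by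
    intro m₁ h₁ m₂ h₂ a ha
    rw [hAB]; exact mem_clspan ⟨m₁, h₁, m₂, h₂, a, ha, rfl⟩
  have NBN : ∀ m₁ ∈ N, ∀ m₂ ∈ N, ∀ a ∈ B, m₁ ∘L (a ∘L adjoint m₂) ∈ C := by
    intro m₁ h₁ m₂ h₂ a ha
    rw [hCB]; exact mem_clspan ⟨m₁, h₁, m₂, h₂, a, ha, rfl⟩
  have NCN : ∀ m₁ ∈ N, ∀ m₂ ∈ N, ∀ b ∈ C, adjoint m₁ ∘L (b ∘L m₂) ∈ B := by
    intro m₁ h₁ m₂ h₂ a ha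
    rw [hBC]; exact mem_clspan ⟨m₁, h₁, m₂, h₂, a, ha, rfl⟩
  have NDM : ∀ n ∈ N, ∀ d ∈ D, ∀ m ∈ M, n ∘L (d ∘L m) ∈ T := by
    intro n hn d hd m hm
    rw [hT]; exact mem_clspan ⟨n, hn, d, hd, m, hm, rfl⟩
  -- D
  have Dmul : ∀ x ∈ D, ∀ y ∈ D, x ∘L y ∈ D := by
    intro x hx y hy
    rw [hD] at hx hy ⊢
    exact mul_mem (S := NonUnitalStarSubalgebra ℂ (K →L[ℂ] K))
      (s := NonUnitalStarSubalgebra.topologicalClosure _) hx hy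
  have Dstar : ∀ x ∈ D, adjoint x ∈ D := by
    intro x hx
    rw [hD] at hx ⊢
    exact star_mem (S := NonUnitalStarSubalgebra ℂ (K →L[ℂ] K))
      (s := NonUnitalStarSubalgebra.topologicalClosure _) hx
  have DM : ∀ m₁ ∈ M, ∀ m₂ ∈ M, m₁ ∘L adjoint m₂ ∈ D := by
    intro m₁ h₁ m₂ h₂
    rw [hD]
    exact subset_closure (NonUnitalStarAlgebra.subset_adjoin ℂ _ (Or.inl ⟨m₁, h₁, m₂, h₂, rfl⟩))
  have DN : ∀ m₁ ∈ N, ∀ m₂ ∈ N, adjoint m₁ ∘L m₂ ∈ D := by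
    intro m₁ h₁ m₂ h₂
    rw [hD]
    exact subset_closure (NonUnitalStarAlgebra.subset_adjoin ℂ _ (Or.inr ⟨m₁, h₁, m₂, h₂, rfl⟩))
  have gM : ∀ m₁ ∈ M, ∀ m₂ ∈ M, ∀ b ∈ B,
      (m₁ ∘L adjoint m₂) ∘L b ∈ B ∧ b ∘L (m₁ ∘L adjoint m₂) ∈ B := by
    intro m₁ h₁ m₂ h₂ b hb
    rw [hBA] at hb
    constructor
    · refine clspan_left sB _ ?_ b hb
      rintro _ ⟨m₃, h₃, m₄, h₄, a, ha, rfl⟩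
      exact MAM _ (hM.2 m₁ h₁ m₂ h₂ m₃ h₃) m₄ h₄ a ha
    · refine clspan_right sB _ ?_ b hb
      rintro _ ⟨m₃, h₃, m₄, h₄, a, ha, rfl⟩
      have := MAM m₃ h₃ _ (hM.2 m₂ h₂ m₁ h₁ m₄ h₄) a ha
      simpa only [adjoint_comp, adjoint_adjoint, comp_assoc] using this
  have gN : ∀ m₁ ∈ N, ∀ m₂ ∈ N, ∀ b ∈ B,
      (adjoint m₁ ∘L m₂) ∘L b ∈ B ∧ b ∘L (adjoint m₁ ∘L m₂) ∈ B := by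
    intro m₁ h₁ m₂ h₂ b hb
    rw [hBC] at hb
    constructor
    · refine clspan_left sB _ ?_ b hb
      rintro _ ⟨m₃, h₃, m₄, h₄, a, ha, rfl⟩
      have := NCN _ (hN.2 m₃ h₃ m₂ h₂ m₁ h₁) m₄ h₄ a ha
      simpa only [adjoint_comp, adjoint_adjoint, comp_assoc] using this
    · refine clspan_right sB _ ?_ b hb
      rintro _ ⟨m₃, h₃, m₄, h₄, a, ha, rfl⟩
      have := NCN m₃ h₃ _ (hN.2 m₄ h₄ m₁ h₁ m₂ h₂) a ha
      simpa only [adjoint_comp, adjoint_adjoint, comp_assoc] using this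
  have DB : ∀ d ∈ D, ∀ b ∈ B, d ∘L b ∈ B ∧ b ∘L d ∈ B := by
    intro d hd b hb
    obtain ⟨hcl, p, hp⟩ := sB
    suffices h : D ⊆ {d | ∀ b ∈ B, d ∘L b ∈ B ∧ b ∘L d ∈ B} from h hd b hb
    rw [hD]
    refine closure_minimal ?_ ?_
    · intro x hx
      suffices h : (∀ b ∈ B, x ∘L b ∈ B ∧ b ∘L x ∈ B) ∧
        (∀ b ∈ B, star x ∘L b ∈ B ∧ b ∘L star x ∈ B) from h.1
      have add : ∀ x y : K →L[ℂ] K, (∀ b ∈ B, x ∘L b ∈ B ∧ b ∘L x ∈ B) →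
          (∀ b ∈ B, y ∘L b ∈ B ∧ b ∘L y ∈ B) → 
          (∀ b ∈ B, (x + y) ∘L b ∈ B ∧ b ∘L (x + y) ∈ B) := by
        intro x y hx hy b hb
        have h1 := hx b hb
        have h2 := hy b hb
        rw [← hp] at h1 h2 ⊢
        rw [add_comp, comp_add]
        exact ⟨p.add_mem h1.1 h2.1, p.add_mem h1.2 h2.2⟩
      have mul : ∀ x y : K →L[ℂ] K, (∀ b ∈ B, x ∘L b ∈ B ∧ b ∘L x ∈ B) →
          (∀ b ∈ B, y ∘L b ∈ B ∧ b ∘L y ∈ B) → 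
          (∀ b ∈ B, (x * y) ∘L b ∈ B ∧ b ∘L (x * y) ∈ B) := by
        intro x y hx hy b hb
        exact ⟨(hx _ (hy b hb).1).1, (hy _ (hx b hb).2).2⟩
      have smul : ∀ (c : ℂ) (x : K →L[ℂ] K), (∀ b ∈ B, x ∘L b ∈ B ∧ b ∘L x ∈ B) →
          (∀ b ∈ B, (c • x) ∘L b ∈ B ∧ b ∘L (c • x) ∈ B) := by
        intro c x hx b hb
        have h1 := hx b hb
        rw [← hp] at h1 ⊢
        rw [smul_comp, comp_smul]
        exact ⟨p.smul_mem _ h1.1, p.smul_mem _ h1.2⟩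
      refine NonUnitalStarAlgebra.adjoin_induction ℂ (p := fun x _ => 
        (∀ b ∈ B, x ∘L b ∈ B ∧ b ∘L x ∈ B) ∧
        (∀ b ∈ B, star x ∘L b ∈ B ∧ b ∘L star x ∈ B)) ?_ ?_ ?_ ?_ ?_ ?_ hx
      · rintro x (⟨m₁, h₁, m₂, h₂, rfl⟩ | ⟨m₁, h₁, m₂, h₂, rfl⟩)
        · refine ⟨gM m₁ h₁ m₂ h₂, ?_⟩
          rw [star_eq_adjoint, adjoint_comp, adjoint_adjoint]
          exact gM m₂ h₂ m₁ h₁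
        · refine ⟨gN m₁ h₁ m₂ h₂, ?_⟩
          rw [star_eq_adjoint, adjoint_comp, adjoint_adjoint]
          exact gN m₂ h₂ m₁ h₁
      · intro x y _ _ hx hy
        rw [star_add]
        exact ⟨add _ _ hx.1 hy.1, add _ _ hx.2 hy.2⟩
      · rw [star_zero, and_self]
        intro b hb
        rw [zero_comp, comp_zero, ← hp]
        exact ⟨p.zero_mem, p.zero_mem⟩
      · intro x y _ _ hx hy
        rw [star_mul]
        exact ⟨mul _ _ hx.1 hy.1, mul _ _ hy.2 hx.2⟩
      · intro c x _ hx
        rw [star_smul]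
        exact ⟨smul _ _ hx.1, smul _ _ hx.2⟩
      · intro x _ hx
        rw [star_star]
        exact ⟨hx.2, hx.1⟩
    · simp only [Set.ofPred_forall]
      refine isClosed_iInter fun b => isClosed_iInter fun hb => ?_
      exact (hcl.preimage (f := fun d : K →L[ℂ] K => d ∘L b) (by fun_prop)).inter
        (hcl.preimage (f := fun d : K →L[ℂ] K => b ∘L d) (by fun_prop))
  refine ⟨?_, ?_, ?_⟩
  · intro t₁ h₁ t₂ h₂ t₃ h₃
    rw [hT] at h₁ h₂ h₃
    refine clspan_right sT _ ?_ t₁ h₁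
    rintro _ ⟨n₁, hn₁, d₁, hd₁, m₁, hm₁, rfl⟩
    refine clspan_sandwich_adj sT _ _ ?_ t₂ h₂
    rintro _ ⟨n₂, hn₂, d₂, hd₂, m₂, hm₂, rfl⟩
    rw [← comp_assoc]
    refine clspan_left sT _ ?_ t₃ h₃
    rintro _ ⟨n₃, hn₃, d₃, hd₃, m₃, hm₃, rfl⟩
    have := NDM n₁ hn₁ _ (Dmul _ hd₁ _ (Dmul _ (DM m₁ hm₁ m₂ hm₂) _ (Dmul _ (Dstar _ hd₂) _
      (Dmul _ (DN n₂ hn₂ n₃ hn₃) _ hd₃)))) m₃ hm₃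
    simpa only [adjoint_comp, adjoint_adjoint, comp_assoc] using this
  · have TAT : ∀ t₁ ∈ T, ∀ t₂ ∈ T, ∀ a ∈ A, t₁ ∘L (a ∘L adjoint t₂) ∈ conjTRO' T A :=
      fun t₁ h₁ t₂ h₂ a ha => mem_clspan ⟨t₁, h₁, t₂, h₂, a, ha, rfl⟩
    have sX : IsClosedSubspace (conjTRO' T A) := clspan_sub _
    apply Set.Subset.antisymm
    · intro c hc
      rw [hCB] at hc
      refine clspan_id sX ?_ c hc
      rintro _ ⟨n₁, hn₁, n₂, hn₂, b, hb, rfl⟩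
      rw [hBA] at hb
      refine clspan_sandwich sX _ _ ?_ b hb
      rintro _ ⟨m₁, hm₁, m₂, hm₂, a, ha, rfl⟩
      rw [hAB] at ha
      have := clspan_sandwich sX (n₁ ∘L m₁) (adjoint m₂ ∘L adjoint n₂) ?_ a ha
      · simpa only [comp_assoc] using this
      rintro _ ⟨m₃, hm₃, m₄, hm₄, b, hb, rfl⟩
      rw [hBA] at hb
      have := clspan_sandwich sX (n₁ ∘L m₁ ∘L adjoint m₃)
        (m₄ ∘L adjoint m₂ ∘L adjoint n₂) ?_ b hb
      · simpa only [comp_assoc] using this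
      rintro _ ⟨m₅, hm₅, m₆, hm₆, a, ha, rfl⟩
      have := TAT _ (NDM n₁ hn₁ _ (DM m₁ hm₁ m₃ hm₃) m₅ hm₅) _
        (NDM n₂ hn₂ _ (DM m₂ hm₂ m₄ hm₄) m₆ hm₆) a ha
      simpa only [adjoint_comp, adjoint_adjoint, comp_assoc] using this
    · refine clspan_id sC ?_
      rintro _ ⟨t₁, h₁, t₂, h₂, a, ha, rfl⟩
      rw [hT] at h₁ h₂
      refine clspan_right sC _ ?_ t₁ h₁
      rintro _ ⟨n₁, hn₁, d₁, hd₁, m₁, hm₁, rfl⟩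
      have := clspan_sandwich_adj sC ((n₁ ∘L d₁ ∘L m₁) ∘L a) (.id ℂ _) ?_ t₂ h₂
      · simpa only [comp_assoc, comp_id] using this
      rintro _ ⟨n₂, hn₂, d₂, hd₂, m₂, hm₂, rfl⟩
      have := NBN n₁ hn₁ n₂ hn₂ _ (DB _ hd₁ _ (DB _ (Dstar _ hd₂) _ (MAM m₁ hm₁ m₂ hm₂ a ha)).2).1
      simpa only [adjoint_comp, adjoint_adjoint, comp_assoc, comp_id] using this
  · have TCT : ∀ t₁ ∈ T, ∀ t₂ ∈ T, ∀ a ∈ C, adjoint t₁ ∘L (a ∘L t₂) ∈ conjTRO T C :=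
      fun t₁ h₁ t₂ h₂ a ha => mem_clspan ⟨t₁, h₁, t₂, h₂, a, ha, rfl⟩
    have sX : IsClosedSubspace (conjTRO T C) := clspan_sub _
    apply Set.Subset.antisymm
    · intro a ha
      rw [hAB] at ha
      refine clspan_id sX ?_ a ha
      rintro _ ⟨m₁, hm₁, m₂, hm₂, b, hb, rfl⟩
      rw [hBA] at hb
      refine clspan_sandwich sX _ _ ?_ b hb
      rintro _ ⟨m₃, hm₃, m₄, hm₄, a, ha, rfl⟩
      rw [hAB] at ha
      have := clspan_sandwich sX (adjoint m₁ ∘L m₃) (adjoint m₄ ∘L m₂) ?_ a ha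
      · simpa only [comp_assoc] using this
      rintro _ ⟨m₅, hm₅, m₆, hm₆, b, hb, rfl⟩
      rw [hBC] at hb
      have := clspan_sandwich sX (adjoint m₁ ∘L m₃ ∘L adjoint m₅)
        (m₆ ∘L adjoint m₄ ∘L m₂) ?_ b hb
      · simpa only [comp_assoc] using this
      rintro _ ⟨n₁, hn₁, n₂, hn₂, c, hc, rfl⟩
      have := TCT _ (NDM n₁ hn₁ _ (DM m₅ hm₅ m₃ hm₃) m₁ hm₁) _
        (NDM n₂ hn₂ _ (DM m₆ hm₆ m₄ hm₄) m₂ hm₂) c hc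
      simpa only [adjoint_comp, adjoint_adjoint, comp_assoc] using this
    · refine clspan_id sA ?_
      rintro _ ⟨t₁, h₁, t₂, h₂, c, hc, rfl⟩
      rw [hT] at h₁ h₂
      rw [← comp_assoc]
      refine clspan_left sA _ ?_ t₂ h₂
      rintro _ ⟨n₂, hn₂, d₂, hd₂, m₂, hm₂, rfl⟩
      have := clspan_sandwich_adj sA (.id ℂ _) (c ∘L (n₂ ∘L d₂ ∘L m₂)) ?_ t₁ h₁
      · simpa only [comp_assoc, id_comp] using this
      rintro _ ⟨n₁, hn₁, d₁, hd₁, m₁, hm₁, rfl⟩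
      have := MBM m₁ hm₁ m₂ hm₂ _
        (DB _ (Dstar _ hd₁) _ (DB _ hd₂ _ (NCN n₁ hn₁ n₂ hn₂ c hc)).2).1
      simpa only [adjoint_comp, adjoint_adjoint, comp_assoc, id_comp] using this
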